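/- Let T > 0, let f : [0,T] × ℝ^d → ℝ^d and σ : [0,T] × ℝ^d → ℝ be smooth, and let p : [0,T] × ℝ^d → (0,∞) be a smooth family of probability densities satisfying the Fokker–Planck equation ∂_τ p_τ = −div(f_τ p_τ) + Δ(σ_τ² p_τ). Let b : [0,T] × ℝ^d → ℝ be smooth. Then the time-reversed family q_τ(y) := p_{T−τ}(y) satisfies the Fokker–Planck equation ∂_τ q_τ = −div(f̄_τ q_τ) + Δ(b_τ² q_τ), where f̄_τ := −f_{T−τ} + ∇(σ_{T−τ}² + b_τ²) + (σ_{T−τ}² + b_τ²) ∇ log p_{T−τ}. -/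

import Mathlib

open MeasureTheory

/-- Partial derivative in the `i`-th coordinate direction of a scalar function on `ℝ^d`. -/
noncomputable def pderiv' (d : ℕ) (i : Fin d) (φ : (Fin d → ℝ) → ℝ) (y : Fin d → ℝ) : ℝ :=
  fderiv ℝ φ y (Pi.single i 1)

/-- Spatial divergence of a vector field on `ℝ^d`. -/
noncomputable def vdiv (d : ℕ) (F : (Fin d → ℝ) → (Fin d → ℝ)) (y : Fin d → ℝ) : ℝ :=
  ∑ i, pderiv' d i (fun y => F y i) y

/-- Spatial Laplacian of a scalar function on `ℝ^d`. -/
noncomputable def vlap (d : ℕ) (φ : (Fin d → ℝ) → ℝ) (y : Fin d → ℝ) : ℝ :=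
  ∑ i, pderiv' d i (fun y => pderiv' d i φ y) y

theorem pderiv'_add {d : ℕ} {i : Fin d} {φ ψ : (Fin d → ℝ) → ℝ} {y : Fin d → ℝ}
    (hφ : DifferentiableAt ℝ φ y) (hψ : DifferentiableAt ℝ ψ y) :
    pderiv' d i (fun y => φ y + ψ y) y = pderiv' d i φ y + pderiv' d i ψ y := by
  simp only [pderiv']
  rw [fderiv_fun_add hφ hψ]
  rfl

theorem pderiv'_sub {d : ℕ} {i : Fin d} {φ ψ : (Fin d → ℝ) → ℝ} {y : Fin d → ℝ}
    (hφ : DifferentiableAt ℝ φ y) (hψ : DifferentiableAt ℝ ψ y) :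
    pderiv' d i (fun y => φ y - ψ y) y = pderiv' d i φ y - pderiv' d i ψ y := by
  simp only [pderiv']
  rw [fderiv_fun_sub hφ hψ]
  rfl

theorem pderiv'_mul {d : ℕ} {i : Fin d} {φ ψ : (Fin d → ℝ) → ℝ} {y : Fin d → ℝ}
    (hφ : DifferentiableAt ℝ φ y) (hψ : DifferentiableAt ℝ ψ y) :
    pderiv' d i (fun y => φ y * ψ y) y = φ y * pderiv' d i ψ y + ψ y * pderiv' d i φ y := by
  simp only [pderiv']
  rw [fderiv_fun_mul hφ hψ]
  simp

theorem ContDiff.differentiable_pderiv' {d : ℕ} {φ : (Fin d → ℝ) → ℝ}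
    (hφ : ContDiff ℝ 2 φ) (i : Fin d) : Differentiable ℝ (pderiv' d i φ) := by
  have h : Differentiable ℝ (fderiv ℝ φ) :=
    (hφ.fderiv_right (m := 1) (by norm_num)).differentiable (by norm_num)
  exact h.clm_apply (differentiable_const _)

/-- The probability flux of the reversed drift: the score term turns
`(-v + ∇(S + B) + (S + B) ∇ log ρ) ρ` into `∇(S ρ) + ∇(B ρ) - v ρ`. -/
theorem reversed_flux_eq {d : ℕ} {i : Fin d} {v S B ρ : (Fin d → ℝ) → ℝ} {y : Fin d → ℝ}
    (hS : DifferentiableAt ℝ S y) (hB : DifferentiableAt ℝ B y) (hρ : DifferentiableAt ℝ ρ y)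
    (hy : ρ y ≠ 0) :
    (- v y + pderiv' d i (fun y => S y + B y) y + (S y + B y) * (pderiv' d i ρ y / ρ y)) * ρ y
      = pderiv' d i (fun y => S y * ρ y) y + pderiv' d i (fun y => B y * ρ y) y - v y * ρ y := by
  rw [pderiv'_add hS hB, pderiv'_mul hS hρ, pderiv'_mul hB hρ]
  field_simp
  ring

theorem vdiv_reversed_flux {d : ℕ} {v : (Fin d → ℝ) → (Fin d → ℝ)} {S B ρ : (Fin d → ℝ) → ℝ}
    (hv : Differentiable ℝ v) (hS : ContDiff ℝ 2 S) (hB : ContDiff ℝ 2 B)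
    (hρ : ContDiff ℝ 2 ρ) (hpos : ∀ y, 0 < ρ y) (y : Fin d → ℝ) :
    vdiv d (fun y i => (- v y i + pderiv' d i (fun y => S y + B y) y
        + (S y + B y) * (pderiv' d i ρ y / ρ y)) * ρ y) y
      = vlap d (fun y => S y * ρ y) y + vlap d (fun y => B y * ρ y) y
        - vdiv d (fun y i => v y i * ρ y) y := by
  have dS := hS.differentiable (by norm_num)
  have dB := hB.differentiable (by norm_num)
  have dρ := hρ.differentiable (by norm_num)
  simp only [vdiv, vlap, ← Finset.sum_add_distrib, ← Finset.sum_sub_distrib]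
  refine Finset.sum_congr rfl fun i _ => ?_
  have hSρ := (hS.mul hρ).differentiable_pderiv' i
  have hBρ := (hB.mul hρ).differentiable_pderiv' i
  have hvρ : Differentiable ℝ fun y => v y i * ρ y := (differentiable_pi.1 hv i).mul dρ
  have hflux := funext fun z => reversed_flux_eq (i := i) (v := fun y => v y i)
    (dS z) (dB z) (dρ z) (hpos z).ne'
  rw [hflux, pderiv'_sub ((hSρ y).fun_add (hBρ y)) (hvρ y), pderiv'_add (hSρ y) (hBρ y)]

theorem ContDiffOn.contDiff_slice {E F G : Type*} [NormedAddCommGroup E] [NormedSpace ℝ E]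
    [NormedAddCommGroup F] [NormedSpace ℝ F] [NormedAddCommGroup G] [NormedSpace ℝ G]
    {n : WithTop ℕ∞} {g : E → F → G} {s : Set E}
    (hg : ContDiffOn ℝ n (fun q : E × F => g q.1 q.2) (s ×ˢ Set.univ)) {t : E} (ht : t ∈ s) :
    ContDiff ℝ n (g t) :=
  hg.comp_contDiff (contDiff_prodMk_right t) fun _ => ⟨ht, trivial⟩

/-- **Backward stochastic dynamic, Fokker–Planck form.**
If `p` is a smooth family of probability densities on `[0,T] × ℝ^d` satisfying the
Fokker–Planck equation `∂_τ p = −div(f p) + Δ(σ² p)`, and `b` is any smooth backward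
noise schedule, then the time-reversed family `q_τ := p_{T−τ}` satisfies the Fokker–Planck
equation `∂_τ q = −div(f̄ q) + Δ(b² q)` with
`f̄_τ = −f_{T−τ} + ∇(σ_{T−τ}² + b_τ²) + (σ_{T−τ}² + b_τ²) ∇log p_{T−τ}`,
where `∇ log p := (∇p)/p`. -/
theorem backward_fokkerPlanck (d : ℕ) (T : ℝ) (hT : 0 < T)
    (f : ℝ → (Fin d → ℝ) → (Fin d → ℝ))
    (σ : ℝ → (Fin d → ℝ) → ℝ)
    (b : ℝ → (Fin d → ℝ) → ℝ)
    (p : ℝ → (Fin d → ℝ) → ℝ)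
    (hf : ContDiffOn ℝ (⊤ : ℕ∞) (fun q : ℝ × (Fin d → ℝ) => f q.1 q.2)
      (Set.Icc 0 T ×ˢ Set.univ))
    (hσ : ContDiffOn ℝ (⊤ : ℕ∞) (fun q : ℝ × (Fin d → ℝ) => σ q.1 q.2)
      (Set.Icc 0 T ×ˢ Set.univ))
    (hb : ContDiffOn ℝ (⊤ : ℕ∞) (fun q : ℝ × (Fin d → ℝ) => b q.1 q.2)
      (Set.Icc 0 T ×ˢ Set.univ))
    (hp : ContDiffOn ℝ (⊤ : ℕ∞) (fun q : ℝ × (Fin d → ℝ) => p q.1 q.2)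
      (Set.Icc 0 T ×ˢ Set.univ))
    (hpos : ∀ τ ∈ Set.Icc 0 T, ∀ y, 0 < p τ y)
    (hprob : ∀ τ ∈ Set.Icc 0 T, Integrable (p τ) ∧ ∫ y, p τ y = 1)
    (hFP : ∀ τ ∈ Set.Icc 0 T, ∀ y,
      deriv (fun s => p s y) τ
        = - vdiv d (fun y i => f τ y i * p τ y) y
          + vlap d (fun y => (σ τ y) ^ 2 * p τ y) y) :
    ∀ τ ∈ Set.Icc 0 T, ∀ y,
      deriv (fun s => p (T - s) y) τ
        = - vdiv d (fun y i =>
            (- f (T - τ) y i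
              + pderiv' d i (fun y => (σ (T - τ) y) ^ 2 + (b τ y) ^ 2) y
              + ((σ (T - τ) y) ^ 2 + (b τ y) ^ 2)
                  * (pderiv' d i (p (T - τ)) y / p (T - τ) y)) * p (T - τ) y) y
          + vlap d (fun y => (b τ y) ^ 2 * p (T - τ) y) y := by
  intro τ hτ y
  have hτ' : T - τ ∈ Set.Icc 0 T := ⟨sub_nonneg.2 hτ.2, sub_le_self T hτ.1⟩
  have h2 : (2 : WithTop ℕ∞) ≤ ((⊤ : ℕ∞) : WithTop ℕ∞) :=
    WithTop.coe_le_coe.2 (le_top : (2 : ℕ∞) ≤ ⊤)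
  have hv : Differentiable ℝ (f (T - τ)) := (hf.contDiff_slice hτ').differentiable (by simp)
  have hS := ((hσ.contDiff_slice hτ').of_le h2).pow 2
  have hB := ((hb.contDiff_slice hτ).of_le h2).pow 2
  have hρ := (hp.contDiff_slice hτ').of_le h2
  rw [deriv_comp_const_sub (f := fun s => p s y), hFP _ hτ' y,
    vdiv_reversed_flux hv hS hB hρ (hpos _ hτ') y]
  ring
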